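/- Let X=X(G) be the flag complex of a finite simple graph G and let k ≥ 1. For every k-cochain φ ∈ C^k(X), Σ_{u∈V} ‖d_{k−1} φ_u‖² = Σ_{σ∈X(k)} (Σ_{τ∈σ(k−1)} deg(τ)) φ(σ)² − 2k Σ_{τ∈X(k−1)} Σ_{vw∈lk(τ)} φ(vτ) φ(wτ), where σ(k−1) denotes the set of (k−1)-faces of σ. -/

import Mathlib

open Finset
open scoped ENNReal
/-- An ordered tuple of vertices spans a simplex of the flag complex `X(G)`
iff its entries are pairwise adjacent. -/
def SimpleGraph.IsFlagSimplex {V : Type*} (G : SimpleGraph V) {m : ℕ} (σ : Fin m → V) : Prop :=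
  ∀ i j : Fin m, i ≠ j → G.Adj (σ i) (σ j)

/-- A (real) simplicial cochain of `X(G)` in degree `m - 1`: a skew-symmetric function
on ordered `m`-tuples of vertices, supported on the ordered simplices of `X(G)`.
(For `m = 0` this is the augmented degree `-1` part, a copy of `ℝ`.) -/
def SimpleGraph.IsFlagCochain {V : Type*} (G : SimpleGraph V) {m : ℕ}
    (φ : (Fin m → V) → ℝ) : Prop :=
  (∀ σ : Fin m → V, ¬ G.IsFlagSimplex σ → φ σ = 0) ∧
  (∀ (σ : Fin m → V) (π : Equiv.Perm (Fin m)),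
    φ (σ ∘ π) = ((Equiv.Perm.sign π : ℤ) : ℝ) * φ σ)

open scoped Classical in
/-- The simplicial coboundary operator `d` of the flag complex `X(G)`:
`(dφ)(σ) = ∑ i, (-1)^i φ(σ with i-th entry removed)` for an ordered simplex `σ`. -/
noncomputable def SimpleGraph.coboundary {V : Type*} (G : SimpleGraph V) {m : ℕ}
    (φ : (Fin m → V) → ℝ) : (Fin (m + 1) → V) → ℝ :=
  fun σ =>
    if G.IsFlagSimplex σ then
      ∑ i : Fin (m + 1), (-1 : ℝ) ^ (i : ℕ) * φ (σ ∘ i.succAbove)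
    else 0
/-- The squared norm of a cochain with respect to the standard inner product: summing
`φ(σ)^2` over the simplices `σ` with a fixed chosen orientation amounts to summing over
all ordered tuples and dividing by the number `m!` of orderings. -/
noncomputable def cochainNormSq {V : Type*} [Fintype V] [DecidableEq V] {m : ℕ}
    (φ : (Fin m → V) → ℝ) : ℝ :=
  ((Nat.factorial m : ℝ))⁻¹ * ∑ σ : Fin m → V, φ σ ^ 2
open scoped Classical in
/-- The degree of a simplex `σ` of `X(G)`: the number of simplices of one higher dimension
containing it, i.e. the number of common neighbours of its vertices. -/
noncomputable def SimpleGraph.simplexDeg {V : Type*} [Fintype V] (G : SimpleGraph V) {m : ℕ}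
    (σ : Fin m → V) : ℕ :=
  (Finset.univ.filter fun u : V => G.IsFlagSimplex (Fin.cons u σ)).card
open scoped Classical in
/-- `φ_u`: the cochain `τ ↦ φ(uτ)` if `u ∈ lk(τ)`, and `0` otherwise. -/
noncomputable def SimpleGraph.cochainRes {V : Type*} (G : SimpleGraph V) {m : ℕ}
    (φ : (Fin (m + 1) → V) → ℝ) (u : V) : (Fin m → V) → ℝ :=
  fun τ => if G.IsFlagSimplex (Fin.cons u τ) then φ (Fin.cons u τ) else 0
open scoped Classical in
/-- `∑_{η ∈ X(m-1)} ∑_{vw ∈ lk(η)} φ(vη)·φ(wη)`: the sum over (unoriented) simplices `η` and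
over (unordered) edges `vw` of the link of `η`; ordered tuples `η` overcount by `m!` and
ordered pairs `(v, w)` overcount each edge of the link twice, whence the normalisation. -/
noncomputable def SimpleGraph.linkEdgeSum {V : Type*} [Fintype V] [DecidableEq V]
    (G : SimpleGraph V) {m : ℕ} (φ : (Fin (m + 1) → V) → ℝ) : ℝ :=
  ((Nat.factorial m : ℝ))⁻¹ * (1 / 2) * ∑ η : Fin m → V, ∑ v : V, ∑ w : V,
    if G.IsFlagSimplex (Fin.cons v (Fin.cons w η)) then φ (Fin.cons v η) * φ (Fin.cons w η)
    else 0

theorem Fin.sum_univ_cons_fun {V M : Type*} [Fintype V] [AddCommMonoid M] {n : ℕ}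
    (F : (Fin (n + 1) → V) → M) :
    ∑ σ, F σ = ∑ v : V, ∑ τ : Fin n → V, F (Fin.cons v τ) := by
  rw [← (Fin.consEquiv (fun _ : Fin (n + 1) => V)).sum_comp, Fintype.sum_prod_type]
  rfl

theorem Fin.cons_cons_comp_swap_zero_one {V : Type*} {n : ℕ} (v w : V) (ρ : Fin n → V) :
    (Fin.cons v (Fin.cons w ρ) : Fin (n + 2) → V) ∘ Equiv.swap 0 1 =
      Fin.cons w (Fin.cons v ρ) :=
  Matrix.cons_cons_comp_swap_zero_one v w ρ

theorem Fintype.sum_comp_perm {ι V M : Type*} [Fintype ι] [DecidableEq ι] [Fintype V]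
    [AddCommMonoid M] (p : Equiv.Perm ι) (F : (ι → V) → M) :
    ∑ σ : ι → V, F (σ ∘ p) = ∑ σ, F σ :=
  (p.symm.arrowCongr (Equiv.refl V)).sum_comp F

theorem Equiv.Perm.exists_apply_eq_and_apply_eq {ι : Type*} [DecidableEq ι] {a b i j : ι}
    (hab : a ≠ b) (hij : i ≠ j) : ∃ p : Equiv.Perm ι, p a = i ∧ p b = j := by
  refine ⟨Equiv.swap (Equiv.swap a i b) j * Equiv.swap a i, ?_, by simp⟩
  rw [Equiv.Perm.mul_apply, Equiv.swap_apply_left]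
  refine Equiv.swap_apply_of_ne_of_ne (fun h => hab ?_) hij
  apply (Equiv.swap a i).injective
  rw [← h, Equiv.swap_apply_left]

theorem Int.cast_units_mul_self {R : Type*} [Ring R] (u : ℤˣ) :
    ((u : ℤ) : R) * ((u : ℤ) : R) = 1 := by
  rw [← Int.cast_mul, ← Units.val_mul, Int.units_mul_self]
  simp

/-- For a skew-symmetric function, removing an entry agrees up to sign with first moving that
entry to the front by any permutation and then removing it. -/
theorem neg_one_pow_mul_comp_succAbove {V : Type*} {n : ℕ} {f : (Fin n → V) → ℝ}
    (hf : ∀ (τ : Fin n → V) (e : Equiv.Perm (Fin n)),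
      f (τ ∘ e) = ((Equiv.Perm.sign e : ℤ) : ℝ) * f τ)
    (σ : Fin (n + 1) → V) (p : Equiv.Perm (Fin (n + 1))) :
    (-1 : ℝ) ^ (p 0 : ℕ) * f (σ ∘ (p 0).succAbove) =
      ((Equiv.Perm.sign p : ℤ) : ℝ) * f (σ ∘ p ∘ Fin.succ) := by
  obtain ⟨⟨a, e⟩, hae⟩ := Equiv.Perm.decomposeFin.symm.surjective ((p 0).cycleRange * p)
  have ha : a = 0 := by
    rw [← Equiv.Perm.decomposeFin_symm_apply_zero a e, hae]
    simp
  subst ha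
  have hs : Equiv.Perm.sign p = (-1) ^ (p 0 : ℕ) * Equiv.Perm.sign e := by
    have h : Equiv.Perm.sign e = Equiv.Perm.sign ((p 0).cycleRange * p) := by
      rw [← hae]; simp
    rw [h, ← Fin.sign_cycleRange, Equiv.Perm.sign_mul, ← mul_assoc, Int.units_mul_self, one_mul]
  have hc : p ∘ Fin.succ = (p 0).succAbove ∘ e := by
    funext x
    apply (p 0).cycleRange.injective
    simpa using (congrArg (fun q => q x.succ) hae).symm
  rw [hc, ← Function.comp_assoc, hf, hs, ← mul_assoc]
  congr 1
  push_cast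
  rw [mul_assoc, Int.cast_units_mul_self, mul_one]

namespace SimpleGraph

variable {V : Type*} (G : SimpleGraph V)

theorem isFlagSimplex_comp_perm {m : ℕ} (σ : Fin m → V) (p : Equiv.Perm (Fin m)) :
    G.IsFlagSimplex (σ ∘ p) ↔ G.IsFlagSimplex σ := by
  constructor
  · intro h i j hij
    simpa using h (p.symm i) (p.symm j) (by simpa using hij)
  · intro h i j hij
    exact h _ _ (by simpa using hij)

theorem isFlagSimplex_cons {m : ℕ} (v : V) (σ : Fin m → V) :
    G.IsFlagSimplex (Fin.cons v σ : Fin (m + 1) → V) ↔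
      (∀ i, G.Adj v (σ i)) ∧ G.IsFlagSimplex σ := by
  simp only [IsFlagSimplex, Fin.forall_fin_succ, Fin.cons_zero, Fin.cons_succ, G.adj_comm _ v]
  simp [Fin.succ_ne_zero, (Fin.succ_ne_zero _).symm, forall_and]

variable {G}

theorem IsFlagCochain.apply_cons_comp_perm {m : ℕ} {φ : (Fin (m + 1) → V) → ℝ}
    (hφ : G.IsFlagCochain φ) (u : V) (τ : Fin m → V) (e : Equiv.Perm (Fin m)) :
    φ (Fin.cons u (τ ∘ e)) = ((Equiv.Perm.sign e : ℤ) : ℝ) * φ (Fin.cons u τ) := by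
  have h := hφ.2 (Fin.cons u τ) (Equiv.Perm.decomposeFin.symm (0, e))
  simp only [Equiv.Perm.decomposeFin.symm_sign, if_true, one_mul] at h
  rw [← h]
  congr 1
  funext x
  refine Fin.cases ?_ (fun x => ?_) x <;> simp

theorem IsFlagCochain.apply_cons_cons_swap {m : ℕ} {φ : (Fin (m + 2) → V) → ℝ}
    (hφ : G.IsFlagCochain φ) (u v : V) (ρ : Fin m → V) :
    φ (Fin.cons u (Fin.cons v ρ)) = -φ (Fin.cons v (Fin.cons u ρ)) := by
  have h := hφ.2 (Fin.cons v (Fin.cons u ρ)) (Equiv.swap 0 1)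
  rw [Equiv.Perm.sign_swap Fin.zero_ne_one] at h
  simp only [Units.val_neg, Units.val_one, Int.cast_neg, Int.cast_one, neg_mul, one_mul] at h
  rw [← h]
  congr 1
  rw [Fin.cons_cons_comp_swap_zero_one]

theorem IsFlagCochain.cochainRes_apply {m : ℕ} {φ : (Fin (m + 1) → V) → ℝ}
    (hφ : G.IsFlagCochain φ) (u : V) (τ : Fin m → V) :
    G.cochainRes φ u τ = φ (Fin.cons u τ) := by
  unfold cochainRes
  split_ifs with h
  · rfl
  · exact (hφ.1 _ h).symm

theorem IsFlagCochain.cochainRes_comp_perm {m : ℕ} {φ : (Fin (m + 1) → V) → ℝ}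
    (hφ : G.IsFlagCochain φ) (u : V) (τ : Fin m → V) (e : Equiv.Perm (Fin m)) :
    G.cochainRes φ u (τ ∘ e) = ((Equiv.Perm.sign e : ℤ) : ℝ) * G.cochainRes φ u τ := by
  simp only [hφ.cochainRes_apply, hφ.apply_cons_comp_perm]

open scoped Classical in
theorem IsFlagCochain.ite_mul_cons_cons {n : ℕ} {φ : (Fin (n + 2) → V) → ℝ}
    (hφ : G.IsFlagCochain φ) (u v w : V) (ρ : Fin n → V) :
    (if G.IsFlagSimplex (Fin.cons v (Fin.cons w ρ)) then
      φ (Fin.cons u (Fin.cons v ρ)) * φ (Fin.cons u (Fin.cons w ρ)) else 0) =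
    if G.IsFlagSimplex (Fin.cons v (Fin.cons w (Fin.cons u ρ))) then
      φ (Fin.cons v (Fin.cons u ρ)) * φ (Fin.cons w (Fin.cons u ρ)) else 0 := by
  rw [hφ.apply_cons_cons_swap u v, hφ.apply_cons_cons_swap u w, neg_mul_neg]
  by_cases hv : G.IsFlagSimplex (Fin.cons v (Fin.cons u ρ))
  · by_cases hw : G.IsFlagSimplex (Fin.cons w (Fin.cons u ρ))
    · refine if_congr ?_ rfl rfl
      simp only [isFlagSimplex_cons, Fin.forall_fin_succ, Fin.cons_zero, Fin.cons_succ] at hv hw ⊢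
      tauto
    · simp [hφ.1 _ hw]
  · simp [hφ.1 _ hv]

variable (G) [Fintype V]

open scoped Classical in
theorem sum_ite_isFlagSimplex_cons {m : ℕ} (F : (Fin m → V) → ℝ) :
    ∑ v : V, ∑ τ : Fin m → V, (if G.IsFlagSimplex (Fin.cons v τ) then F τ else 0) =
      ∑ τ, (G.simplexDeg τ : ℝ) * F τ := by
  rw [Finset.sum_comm]
  refine Finset.sum_congr rfl fun τ _ => ?_
  rw [← Finset.sum_filter, Finset.sum_const, nsmul_eq_mul]
  rfl

open scoped Classical in
/-- The diagonal terms in the expansion of the squared norm of a coboundary. -/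
theorem sum_sq_comp_succAbove {n : ℕ} {f : (Fin n → V) → ℝ}
    (hf : ∀ (τ : Fin n → V) (e : Equiv.Perm (Fin n)),
      f (τ ∘ e) = ((Equiv.Perm.sign e : ℤ) : ℝ) * f τ) (i : Fin (n + 1)) :
    ∑ σ : Fin (n + 1) → V, (if G.IsFlagSimplex σ then
      ((-1 : ℝ) ^ (i : ℕ) * f (σ ∘ i.succAbove)) * ((-1 : ℝ) ^ (i : ℕ) * f (σ ∘ i.succAbove))
      else 0) = ∑ τ, (G.simplexDeg τ : ℝ) * f τ ^ 2 := by
  obtain ⟨p, rfl⟩ : ∃ p : Equiv.Perm (Fin (n + 1)), p 0 = i := ⟨Equiv.swap 0 i, by simp⟩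
  simp only [neg_one_pow_mul_comp_succAbove hf]
  rw [← G.sum_ite_isFlagSimplex_cons]
  refine Eq.trans ?_ (Fin.sum_univ_cons_fun (fun σ : Fin (n + 1) → V =>
    if G.IsFlagSimplex σ then f (σ ∘ Fin.succ) ^ 2 else 0))
  refine Eq.trans ?_ (Fintype.sum_comp_perm p _)
  refine Finset.sum_congr rfl fun σ _ => ?_
  rw [G.isFlagSimplex_comp_perm, mul_mul_mul_comm, Int.cast_units_mul_self, one_mul, sq]
  rfl

open scoped Classical in
/-- The off-diagonal terms in the expansion of the squared norm of a coboundary. -/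
theorem sum_mul_comp_succAbove {n : ℕ} {f : (Fin (n + 1) → V) → ℝ}
    (hf : ∀ (τ : Fin (n + 1) → V) (e : Equiv.Perm (Fin (n + 1))),
      f (τ ∘ e) = ((Equiv.Perm.sign e : ℤ) : ℝ) * f τ) {i j : Fin (n + 2)} (hij : i ≠ j) :
    ∑ σ : Fin (n + 2) → V, (if G.IsFlagSimplex σ then
      ((-1 : ℝ) ^ (i : ℕ) * f (σ ∘ i.succAbove)) * ((-1 : ℝ) ^ (j : ℕ) * f (σ ∘ j.succAbove))
      else 0) = -∑ v : V, ∑ w : V, ∑ ρ : Fin n → V,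
        if G.IsFlagSimplex (Fin.cons v (Fin.cons w ρ)) then
          f (Fin.cons v ρ) * f (Fin.cons w ρ) else 0 := by
  obtain ⟨p, rfl, rfl⟩ := Equiv.Perm.exists_apply_eq_and_apply_eq Fin.zero_ne_one hij
  have hp : p 1 = (p * Equiv.swap 0 1 : Equiv.Perm (Fin (n + 2))) 0 := by simp
  have hsign : Equiv.Perm.sign (p * Equiv.swap 0 1) = -Equiv.Perm.sign p := by
    simp
  rw [hp]
  simp only [neg_one_pow_mul_comp_succAbove hf, hsign]
  simp only [← Finset.sum_neg_distrib]
  calc _ = ∑ σ : Fin (n + 2) → V, (if G.IsFlagSimplex σ then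
        -(f ((σ ∘ Equiv.swap 0 1) ∘ Fin.succ) * f (σ ∘ Fin.succ)) else 0) := by
        refine Eq.trans ?_ (Fintype.sum_comp_perm p _)
        refine Finset.sum_congr rfl fun σ _ => ?_
        rw [G.isFlagSimplex_comp_perm, mul_mul_mul_comm, Units.val_neg, Int.cast_neg, mul_neg,
          Int.cast_units_mul_self, neg_one_mul, mul_comm (f _)]
        rfl
    _ = _ := by
        rw [Fin.sum_univ_cons_fun]
        refine Finset.sum_congr rfl fun v _ => ?_
        rw [Fin.sum_univ_cons_fun]
        refine Finset.sum_congr rfl fun w _ => Finset.sum_congr rfl fun ρ _ => ?_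
        have h1 : ((Fin.cons v (Fin.cons w ρ) : Fin (n + 2) → V) ∘ Equiv.swap 0 1) ∘ Fin.succ =
            Fin.cons v ρ := by
          rw [Fin.cons_cons_comp_swap_zero_one]
          rfl
        have h2 : (Fin.cons v (Fin.cons w ρ) : Fin (n + 2) → V) ∘ Fin.succ = Fin.cons w ρ := rfl
        rw [h1, h2]
        split_ifs <;> simp

open scoped Classical in
theorem sum_coboundary_sq {n : ℕ} {f : (Fin (n + 1) → V) → ℝ}
    (hf : ∀ (τ : Fin (n + 1) → V) (e : Equiv.Perm (Fin (n + 1))),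
      f (τ ∘ e) = ((Equiv.Perm.sign e : ℤ) : ℝ) * f τ) :
    ∑ σ, G.coboundary f σ ^ 2 =
      (n + 2) * ∑ τ, (G.simplexDeg τ : ℝ) * f τ ^ 2 -
      (n + 2) * (n + 1) * ∑ v : V, ∑ w : V, ∑ ρ : Fin n → V,
        if G.IsFlagSimplex (Fin.cons v (Fin.cons w ρ)) then
          f (Fin.cons v ρ) * f (Fin.cons w ρ) else 0 := by
  set A := ∑ τ, (G.simplexDeg τ : ℝ) * f τ ^ 2 with hA
  set B := ∑ v : V, ∑ w : V, ∑ ρ : Fin n → V,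
    if G.IsFlagSimplex (Fin.cons v (Fin.cons w ρ)) then
      f (Fin.cons v ρ) * f (Fin.cons w ρ) else 0 with hB
  have hterm (i j : Fin (n + 2)) : ∑ σ : Fin (n + 2) → V, (if G.IsFlagSimplex σ then
      ((-1 : ℝ) ^ (i : ℕ) * f (σ ∘ i.succAbove)) * ((-1 : ℝ) ^ (j : ℕ) * f (σ ∘ j.succAbove))
      else 0) = -B + if i = j then A + B else 0 := by
    split_ifs with hij
    · subst hij
      rw [G.sum_sq_comp_succAbove hf]
      ring
    · rw [G.sum_mul_comp_succAbove hf hij, add_zero]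
  calc _ = ∑ i : Fin (n + 2), ∑ j : Fin (n + 2), ∑ σ : Fin (n + 2) → V,
      (if G.IsFlagSimplex σ then ((-1 : ℝ) ^ (i : ℕ) * f (σ ∘ i.succAbove)) *
        ((-1 : ℝ) ^ (j : ℕ) * f (σ ∘ j.succAbove)) else 0) := by
        simp only [Finset.sum_comm (t := (Finset.univ : Finset (Fin (n + 2) → V)))]
        refine Finset.sum_congr rfl fun σ _ => ?_
        unfold coboundary
        split_ifs with h
        · rw [sq, Finset.sum_mul_sum]
        · simp
    _ = _ := by
        simp only [hterm, Finset.sum_add_distrib, Finset.sum_const, Finset.sum_ite_eq,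
          Finset.mem_univ, if_true, Finset.card_univ, Fintype.card_fin, nsmul_eq_mul]
        push_cast
        ring

variable {G}

theorem IsFlagCochain.sum_simplexDeg_comp_succAbove {m : ℕ} {φ : (Fin (m + 1) → V) → ℝ}
    (hφ : G.IsFlagCochain φ) (i : Fin (m + 1)) :
    ∑ σ, (G.simplexDeg (σ ∘ i.succAbove) : ℝ) * φ σ ^ 2 =
      ∑ u, ∑ τ, (G.simplexDeg τ : ℝ) * φ (Fin.cons u τ) ^ 2 := by
  refine Eq.trans ?_ (Fin.sum_univ_cons_fun (fun σ : Fin (m + 1) → V =>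
    (G.simplexDeg (σ ∘ Fin.succ) : ℝ) * φ σ ^ 2))
  refine Eq.trans ?_ (Fintype.sum_comp_perm i.cycleRange.symm _)
  refine Finset.sum_congr rfl fun σ _ => ?_
  have h : (σ ∘ i.cycleRange.symm) ∘ Fin.succ = σ ∘ i.succAbove := by
    funext x
    simp
  rw [h, hφ.2, mul_pow, sq (((Equiv.Perm.sign _ : ℤˣ) : ℤ) : ℝ), Int.cast_units_mul_self, one_mul]

end SimpleGraph

/-- **Claim 3.2**: for a `k`-cochain `φ` of the flag complex `X(G)` with `k ≥ 1`,
`∑_{u∈V} ‖d_{k-1} φ_u‖² = ∑_{σ∈X(k)} (∑_{τ∈σ(k-1)} deg(τ))·φ(σ)²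
− 2k·∑_{τ∈X(k-1)} ∑_{vw∈lk(τ)} φ(vτ)·φ(wτ)`. -/
theorem sum_normSq_coboundary_cochainRes {V : Type*} [Fintype V] [DecidableEq V]
    (G : SimpleGraph V) (k : ℕ) (hk : 1 ≤ k) (φ : (Fin (k + 1) → V) → ℝ)
    (hφ : G.IsFlagCochain φ) :
    ∑ u : V, cochainNormSq (G.coboundary (G.cochainRes φ u)) =
      ((Nat.factorial (k + 1) : ℝ))⁻¹ *
          (∑ σ : Fin (k + 1) → V,
            (∑ i : Fin (k + 1), (G.simplexDeg (σ ∘ i.succAbove) : ℝ)) * φ σ ^ 2) -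
        2 * (k : ℝ) * G.linkEdgeSum φ := by
  classical
  obtain ⟨n, rfl⟩ : ∃ n, k = n + 1 := ⟨k - 1, by omega⟩
  have hdeg : ∑ σ : Fin (n + 1 + 1) → V,
      (∑ i : Fin (n + 1 + 1), (G.simplexDeg (σ ∘ i.succAbove) : ℝ)) * φ σ ^ 2 =
      (n + 2) * ∑ u, ∑ τ, (G.simplexDeg τ : ℝ) * φ (Fin.cons u τ) ^ 2 := by
    simp only [Finset.sum_mul]
    rw [Finset.sum_comm]
    simp only [hφ.sum_simplexDeg_comp_succAbove, Finset.sum_const, Finset.card_univ,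
      Fintype.card_fin, nsmul_eq_mul]
    push_cast
    ring
  have hlink : ∑ u : V, ∑ v : V, ∑ w : V, ∑ ρ : Fin n → V,
      (if G.IsFlagSimplex (Fin.cons v (Fin.cons w ρ)) then
        φ (Fin.cons u (Fin.cons v ρ)) * φ (Fin.cons u (Fin.cons w ρ)) else 0) =
      ∑ η : Fin (n + 1) → V, ∑ v : V, ∑ w : V,
        if G.IsFlagSimplex (Fin.cons v (Fin.cons w η)) then
          φ (Fin.cons v η) * φ (Fin.cons w η) else 0 := by
    rw [Fin.sum_univ_cons_fun]
    refine Finset.sum_congr rfl fun u _ => ?_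
    simp only [hφ.ite_mul_cons_cons]
    simp only [Finset.sum_comm (s := (Finset.univ : Finset V))
      (t := (Finset.univ : Finset (Fin n → V)))]
  unfold cochainNormSq SimpleGraph.linkEdgeSum
  simp only [G.sum_coboundary_sq (hφ.cochainRes_comp_perm _), hφ.cochainRes_apply]
  rw [← hlink, hdeg, ← Finset.mul_sum, Finset.sum_sub_distrib, ← Finset.mul_sum, ← Finset.mul_sum]
  rw [Nat.factorial_succ (n + 1)]
  have : (Nat.factorial (n + 1) : ℝ) ≠ 0 := by positivity
  push_cast
  field_simp
  ring
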